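/- arXiv:2305.13492 — 2 statements merged into one kernel-verified Lean document; each statement's English description precedes it below -/
import Mathlib

section
/- Let fₙ = ãₙ / aₙ, where ãₙ is the (n−1)-dimensional Hausdorff measure of {z ∈ ℝⁿ : ‖z‖₂ = 1, ‖z‖_∞ ≤ 1/2} and aₙ is the (n−1)-dimensional Hausdorff measure of the full unit sphere {z ∈ ℝⁿ : ‖z‖₂ = 1}. Then fₙ → 1 as n → ∞. -/
open MeasureTheory Filter

namespace TorusTan

abbrev EE (m : ℕ) := EuclideanSpace ℝ (Fin (m + 1))

abbrev SS (m : ℕ) : Set (EE m) := {z | ‖z‖ = 1}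

lemma SS_eq (m : ℕ) : SS m = Metric.sphere 0 1 := by ext z; simp

lemma SS_meas (m : ℕ) : MeasurableSet (SS m) := by
  rw [SS_eq]; exact Metric.isClosed_sphere.measurableSet

lemma norm_one_iff (m : ℕ) (z : EE m) : ‖z‖ = 1 ↔ ∑ i, z i ^ 2 = 1 := by
  rw [EuclideanSpace.norm_eq, Real.sqrt_eq_one]
  simp

/-- the radial chart -/
noncomputable def gg (m : ℕ) (i : Fin (m + 1)) (x : Fin m → ℝ) : EE m :=
  WithLp.toLp 2 (fun j => i.insertNth (α := fun _ => ℝ) 1 x j / Real.sqrt (1 + ∑ k, x k ^ 2))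

lemma gg_contDiff (m : ℕ) (i : Fin (m + 1)) : ContDiff ℝ 1 (gg m i) := by
  unfold gg
  rw [contDiff_euclidean]
  intro j
  have hpos : ∀ x : Fin m → ℝ, 0 < 1 + ∑ k, x k ^ 2 := fun x => by positivity
  refine ContDiff.div ?_ (ContDiff.sqrt (by fun_prop) fun x => (hpos x).ne') ?_
  · refine Fin.succAboveCases i ?_ (fun k => ?_) j
    · simpa using contDiff_const
    · simp only [Fin.insertNth_apply_succAbove]; fun_prop
  · intro x; exact (Real.sqrt_pos.2 (hpos x)).ne'

lemma SS_subset (m : ℕ) :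
    SS m ⊆ ⋃ i, (gg m i '' Set.Icc (-1) 1 ∪ (fun z => -z) '' (gg m i '' Set.Icc (-1) 1)) := by
  intro z hz
  have hz1 := (norm_one_iff m z).1 hz
  obtain ⟨i, -, hi⟩ := Finset.exists_max_image Finset.univ (fun i => |z i|) Finset.univ_nonempty
  have hi0 : z i ≠ 0 := by
    intro h0
    have : ∀ j, z j = 0 := fun j => by
      have := hi j (Finset.mem_univ _)
      simpa [h0] using this
    simp [this] at hz1
  have hapos : 0 < |z i| := abs_pos.2 hi0
  refine Set.mem_iUnion.2 ⟨i, ?_⟩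
  have hx : (fun k => z (i.succAbove k) / z i) ∈ Set.Icc (-1 : Fin m → ℝ) 1 := by
    have : ∀ k, |z (i.succAbove k) / z i| ≤ 1 := fun k => by
      rw [abs_div, div_le_one hapos]; exact hi _ (Finset.mem_univ _)
    exact ⟨fun k => (abs_le.1 (this k)).1, fun k => (abs_le.1 (this k)).2⟩
  have hs : Real.sqrt (1 + ∑ k, (z (i.succAbove k) / z i) ^ 2) = |z i|⁻¹ := by
    rw [Fin.sum_univ_succAbove _ i] at hz1
    have : 1 + ∑ k, (z (i.succAbove k) / z i) ^ 2 = (|z i|⁻¹) ^ 2 := by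
      simp only [div_pow]
      rw [← Finset.sum_div, inv_pow, sq_abs]
      field_simp
      linarith
    rw [this, Real.sqrt_sq (by positivity)]
  have hg : ∀ j, gg m i (fun k => z (i.succAbove k) / z i) j = z j / z i * |z i| := by
    intro j
    simp only [gg, hs]
    rw [div_inv_eq_mul]
    congr 1
    refine Fin.succAboveCases i ?_ (fun k => ?_) j
    · simp [hi0]
    · simp
  rcases lt_or_gt_of_ne hi0 with h | h
  · right
    refine ⟨_, ⟨_, hx, rfl⟩, ?_⟩
    ext j
    simp only [PiLp.neg_apply, hg, abs_of_neg h]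
    field_simp
  · left
    refine ⟨_, hx, ?_⟩
    ext j
    simp only [hg, abs_of_pos h]
    field_simp

lemma fin_meas (m : ℕ) : Measure.hausdorffMeasure (m : ℝ) (SS m) < ⊤ := by
  have key : ∀ i, Measure.hausdorffMeasure (m : ℝ) (gg m i '' Set.Icc (-1) 1) < ⊤ := by
    intro i
    obtain ⟨K, hK⟩ := ((gg_contDiff m i).locallyLipschitz.locallyLipschitzOn
      (s := Set.Icc (-1) 1)).exists_lipschitzOnWith_of_compact isCompact_Icc
    refine (hK.hausdorffMeasure_image_le (Nat.cast_nonneg m)).trans_lt ?_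
    have h1 : (Measure.hausdorffMeasure (m : ℝ) : Measure (Fin m → ℝ)) = volume := by
      have := hausdorffMeasure_pi_real (ι := Fin m)
      rwa [Fintype.card_fin] at this
    rw [h1]
    exact ENNReal.mul_lt_top (ENNReal.rpow_lt_top_of_nonneg (Nat.cast_nonneg m) (by simp))
      isCompact_Icc.measure_lt_top
  refine (measure_mono (SS_subset m)).trans_lt ?_
  refine (measure_iUnion_fintype_le _ _).trans_lt ?_
  refine ENNReal.sum_lt_top.2 fun i _ => ?_
  refine (measure_union_le _ _).trans_lt (ENNReal.add_lt_top.2 ⟨key i, ?_⟩)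
  have hneg : Isometry (fun z : EE m => -z) := isometry_neg
  rw [hneg.hausdorffMeasure_image (Or.inl (Nat.cast_nonneg m))]
  exact key i

lemma pos_meas (m : ℕ) : 0 < Measure.hausdorffMeasure (m : ℝ) (SS m) := by
  have hL : LipschitzWith 1 (fun z : EE m => fun k : Fin m => z k.succ) := by
    refine LipschitzWith.of_dist_le_mul fun x y => ?_
    rw [NNReal.coe_one, one_mul, dist_pi_le_iff dist_nonneg]
    intro k
    rw [dist_eq_norm, dist_eq_norm]
    exact PiLp.norm_apply_le (x - y) k.succ
  have h := hL.hausdorffMeasure_image_le (Nat.cast_nonneg m) (SS m)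
  have h1 : (Measure.hausdorffMeasure (m : ℝ) : Measure (Fin m → ℝ)) = volume := by
    have := hausdorffMeasure_pi_real (ι := Fin m)
    rwa [Fintype.card_fin] at this
  rw [h1] at h
  simp only [ENNReal.coe_one, ENNReal.one_rpow, one_mul] at h
  refine lt_of_lt_of_le ?_ h
  have hsub : {x : Fin m → ℝ | ∑ k, x k ^ 2 < 1} ⊆
      (fun z : EE m => fun k : Fin m => z k.succ) '' SS m := by
    intro x hx
    refine ⟨WithLp.toLp 2 (Fin.cons (Real.sqrt (1 - ∑ k, x k ^ 2)) x), ?_, ?_⟩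
    · refine (norm_one_iff m _).2 ?_
      rw [Fin.sum_univ_succ]
      have hx' : ∑ k, x k ^ 2 < 1 := hx
      simp [Real.sq_sqrt (by linarith : 0 ≤ 1 - ∑ k, x k ^ 2)]
    · ext k; simp
  refine lt_of_lt_of_le ?_ (measure_mono hsub)
  refine IsOpen.measure_pos _ (isOpen_lt (by fun_prop) continuous_const) ⟨0, by simp⟩

noncomputable abbrev nu (m : ℕ) : Measure (EE m) :=
  (Measure.hausdorffMeasure (m : ℝ)).restrict (SS m)

instance (m : ℕ) : IsFiniteMeasure (nu m) := ⟨by simpa using fin_meas m⟩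

lemma integ (m : ℕ) (f : EE m → ℝ) (hf : Continuous f) : Integrable f (nu m) := by
  have hc : IsCompact (SS m) := by rw [SS_eq]; exact isCompact_sphere _ _
  obtain ⟨C, hC⟩ := hc.exists_bound_of_continuousOn hf.continuousOn
  refine Integrable.of_bound hf.aestronglyMeasurable C ?_
  filter_upwards [ae_restrict_mem (SS_meas m)] with x hx using hC x hx

lemma inv (m : ℕ) (T : EE m ≃ₗᵢ[ℝ] EE m) (f : EE m → ℝ) :
    ∫ z, f (T z) ∂(nu m) = ∫ z, f z ∂(nu m) := by
  have h := (T.toIsometryEquiv.measurePreserving_hausdorffMeasure (m : ℝ)).restrict_preimage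
    (SS_meas m)
  have hp : T.toIsometryEquiv ⁻¹' (SS m) = SS m := by ext z; simp
  rw [hp] at h
  exact h.integral_comp T.toIsometryEquiv.toHomeomorph.measurableEmbedding f

lemma inv4 (m : ℕ) (v w : EE m) (h : ‖v‖ = ‖w‖) :
    ∫ z, (inner ℝ v z : ℝ) ^ 4 ∂(nu m) = ∫ z, (inner ℝ w z : ℝ) ^ 4 ∂(nu m) := by
  have hr := Submodule.reflection_sub h
  rw [← hr, ← inv m (Submodule.reflection (Submodule.span ℝ {v - w})ᗮ)]
  refine integral_congr_ae (.of_forall fun z => ?_)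
  simp only
  rw [← LinearIsometryEquiv.inner_map_map (Submodule.reflection (Submodule.span ℝ {v - w})ᗮ) v,
    Submodule.reflection_reflection]

lemma moment (m : ℕ) (i j : Fin (m + 1)) (hij : i ≠ j) :
    ∫ z, (z i ^ 4 + z j ^ 4) ∂(nu m) = 6 * ∫ z, z i ^ 2 * z j ^ 2 ∂(nu m) := by
  have hn : ∀ a b c : ℝ, 0 ≤ c → a ^ 2 + b ^ 2 = c ^ 2 →
      ‖(EuclideanSpace.single i a + EuclideanSpace.single j b : EE m)‖ = c := by
    intro a b c hc h
    rw [EuclideanSpace.norm_eq, ← Real.sqrt_sq hc, ← h]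
    congr 1
    have : ∀ k, ‖(EuclideanSpace.single i a + EuclideanSpace.single j b : EE m) k‖ ^ 2
        = (if k = i then a ^ 2 else 0) + (if k = j then b ^ 2 else 0) := by
      intro k
      by_cases h1 : k = i
      · subst h1; simp [hij]
      · by_cases h2 : k = j
        · subst h2; simp [h1]
        · simp [h1, h2]
    rw [Finset.sum_congr rfl fun k _ => this k]
    simp [Finset.sum_add_distrib]
  have hE : ∀ a b a' b' : ℝ, a ^ 2 + b ^ 2 = a' ^ 2 + b' ^ 2 →
      ∫ z, (a * z i + b * z j) ^ 4 ∂(nu m) = ∫ z, (a' * z i + b' * z j) ^ 4 ∂(nu m) := by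
    intro a b a' b' h
    have := inv4 m (EuclideanSpace.single i a + EuclideanSpace.single j b)
      (EuclideanSpace.single i a' + EuclideanSpace.single j b')
      (by rw [hn a b _ (Real.sqrt_nonneg _) (Real.sq_sqrt (by positivity)).symm,
            hn a' b' _ (Real.sqrt_nonneg _) (Real.sq_sqrt (by positivity)).symm, h])
    simpa [inner_add_left, EuclideanSpace.inner_single_left] using this
  have e1 := hE 3 4 5 0 (by norm_num)
  have e2 := hE 3 (-4) 0 5 (by norm_num)
  have hI : ∀ a b : ℝ, Integrable (fun z : EE m => (a * z i + b * z j) ^ 4) (nu m) :=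
    fun a b => integ m _ (by fun_prop)
  have e3 := congrArg₂ (· + ·) e1 e2
  simp only at e3
  rw [← integral_add (hI _ _) (hI _ _), ← integral_add (hI _ _) (hI _ _)] at e3
  have e4 : ∫ z : EE m, ((3 * z i + 4 * z j) ^ 4 + (3 * z i + -4 * z j) ^ 4) ∂(nu m) =
      ∫ z : EE m, (162 * z i ^ 4 + 512 * z j ^ 4 + 1728 * (z i ^ 2 * z j ^ 2)) ∂(nu m) := by
    congr 1; ext z; ring
  have i1 : Integrable (fun z : EE m => z i ^ 4) (nu m) := integ m _ (by fun_prop)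
  have i2 : Integrable (fun z : EE m => z j ^ 4) (nu m) := integ m _ (by fun_prop)
  have i3 : Integrable (fun z : EE m => z i ^ 2 * z j ^ 2) (nu m) := integ m _ (by fun_prop)
  have i12 : Integrable (fun z : EE m => 162 * z i ^ 4 + 512 * z j ^ 4) (nu m) :=
    integ m _ (by fun_prop)
  rw [e4, integral_add i12 (i3.const_mul _),
    integral_add (i1.const_mul _) (i2.const_mul _)] at e3
  have e5 : ∫ z : EE m, ((5 * z i + 0 * z j) ^ 4 + (0 * z i + 5 * z j) ^ 4) ∂(nu m) =
      ∫ z : EE m, (625 * z i ^ 4 + 625 * z j ^ 4) ∂(nu m) := by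
    congr 1; ext z; ring
  rw [e5, integral_add (i1.const_mul _) (i2.const_mul _)] at e3
  have e6 := hE 1 0 0 1 (by norm_num)
  simp only [one_mul, zero_mul, add_zero, zero_add] at e6
  simp only [integral_const_mul] at e3
  rw [integral_add i1 i2]
  linarith

lemma moment_sum (m : ℕ) :
    ((m : ℝ) + 3) * ∫ z, (∑ i, z i ^ 4) ∂(nu m) = 3 * (nu m).real Set.univ := by
  have i4 : ∀ i, Integrable (fun z : EE m => z i ^ 4) (nu m) := fun i => integ m _ (by fun_prop)
  have i3 : ∀ i j, Integrable (fun z : EE m => z i ^ 2 * z j ^ 2) (nu m) :=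
    fun i j => integ m _ (by fun_prop)
  set A : Fin (m + 1) → ℝ := fun i => ∫ z, z i ^ 4 ∂(nu m) with hA
  set B : Fin (m + 1) → Fin (m + 1) → ℝ := fun i j => ∫ z, z i ^ 2 * z j ^ 2 ∂(nu m) with hB
  have hAB : ∀ i j, A i + A j = 6 * B i j - (if i = j then 4 * A i else 0) := by
    intro i j
    by_cases h : i = j
    · subst h
      have : B i i = A i := by
        simp only [hA, hB]; congr 1; ext z; ring
      rw [this]; simp; ring
    · have := moment m i j h
      rw [integral_add (i4 i) (i4 j)] at this
      simp only [h, if_false, sub_zero]; exact this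
  have hBsum : ∑ i, ∑ j, B i j = (nu m).real Set.univ := by
    simp only [hB]
    simp_rw [← integral_finsetSum Finset.univ (fun j _ => i3 _ j)]
    rw [← integral_finsetSum Finset.univ (fun i _ => integrable_finsetSum _ fun j _ => i3 i j)]
    have : ∫ z : EE m, (∑ i, ∑ j, z i ^ 2 * z j ^ 2) ∂(nu m) = ∫ z : EE m, (1 : ℝ) ∂(nu m) := by
      refine integral_congr_ae ?_
      filter_upwards [ae_restrict_mem (SS_meas m)] with z hz
      rw [← Finset.sum_mul_sum, (norm_one_iff m z).1 hz, one_mul]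
    rw [this]; simp
  have hs : ∑ i, ∑ j, (A i + A j) = ∑ i, ∑ j, (6 * B i j - (if i = j then 4 * A i else 0)) :=
    Finset.sum_congr rfl fun i _ => Finset.sum_congr rfl fun j _ => hAB i j
  simp only [Finset.sum_add_distrib, Finset.sum_sub_distrib, ← Finset.mul_sum, hBsum,
    Finset.sum_ite_eq, Finset.mem_univ, if_true, Finset.sum_const, Finset.card_univ,
    Fintype.card_fin, nsmul_eq_mul] at hs
  rw [integral_finsetSum _ fun i _ => i4 i]
  push_cast at hs
  change ((m : ℝ) + 3) * ∑ i, A i = _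
  linarith

lemma bound (m : ℕ) :
    1 - 48 / ((m : ℝ) + 3) ≤ (Measure.hausdorffMeasure (m : ℝ)
          {z : EE m | ‖z‖ = 1 ∧ ∀ i, |z i| ≤ 1 / 2}).toReal /
      (Measure.hausdorffMeasure (m : ℝ) {z : EE m | ‖z‖ = 1}).toReal := by
  have hpos : 0 < (nu m).real Set.univ := by
    rw [measureReal_def, Measure.restrict_apply_univ]
    exact ENNReal.toReal_pos (pos_meas m).ne' (fin_meas m).ne
  set G : Set (EE m) := {z | ∀ i, |z i| ≤ 1 / 2} with hG
  have hGm : MeasurableSet G := by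
    have : IsClosed G := by
      simp only [hG, Set.setOf_forall]
      exact isClosed_iInter fun i => isClosed_le (by fun_prop) continuous_const
    exact this.measurableSet
  have h1 : (Measure.hausdorffMeasure (m : ℝ) {z : EE m | ‖z‖ = 1}).toReal =
      (nu m).real Set.univ := by
    rw [measureReal_def, Measure.restrict_apply_univ]
  have h2 : (Measure.hausdorffMeasure (m : ℝ)
      {z : EE m | ‖z‖ = 1 ∧ ∀ i, |z i| ≤ 1 / 2}).toReal = (nu m).real G := by
    rw [measureReal_def, Measure.restrict_apply hGm]
    congr 2; ext z; simp [hG, and_comm]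
  rw [h1, h2, le_div_iff₀ hpos]
  have hc := measureReal_add_measureReal_compl (μ := nu m) hGm
  have hM := mul_meas_ge_le_integral_of_nonneg (μ := nu m)
    (f := fun z : EE m => ∑ i, z i ^ 4) (.of_forall fun z => by positivity)
    (integ m _ (by fun_prop)) (1 / 16)
  have hle : (nu m).real Gᶜ ≤ (nu m).real {z : EE m | 1 / 16 ≤ ∑ i, z i ^ 4} := by
    refine measureReal_mono ?_
    intro z hz
    simp only [hG, Set.mem_compl_iff, Set.mem_setOf_eq, not_forall, not_le] at hz
    obtain ⟨i, hi⟩ := hz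
    have a1 : z i ^ 4 ≤ ∑ i, z i ^ 4 :=
      Finset.single_le_sum (f := fun i => z i ^ 4) (fun j _ => by positivity) (Finset.mem_univ i)
    have a2 : (1 / 2 : ℝ) ^ 4 ≤ |z i| ^ 4 := pow_le_pow_left₀ (by norm_num) hi.le 4
    rw [Even.pow_abs (by decide)] at a2
    refine le_trans ?_ a1
    norm_num at a2 ⊢
    exact a2
  have hms := moment_sum m
  have hm3 : (0 : ℝ) < (m : ℝ) + 3 := by positivity
  have hI : ∫ z, (∑ i, z i ^ 4) ∂(nu m) = 3 * (nu m).real Set.univ / ((m : ℝ) + 3) := by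
    rw [eq_div_iff hm3.ne']; linarith
  have : 48 / ((m : ℝ) + 3) * (nu m).real Set.univ
      = 16 * (3 * (nu m).real Set.univ / ((m : ℝ) + 3)) := by ring
  rw [sub_mul, this, ← hI]
  linarith

end TorusTan

/-- the fraction `fₙ = ãₙ/aₙ` of the unit sphere of `ℝⁿ` available for
tangencies in the unit `n`-torus (the relative `(n−1)`-dimensional Hausdorff measure of
the part of the unit sphere with `‖z‖_∞ ≤ 1/2`) tends to `1` as `n → ∞`. -/
theorem torus_tangency_fraction_tendsto_one :
    Tendsto (fun n : ℕ =>
      (Measure.hausdorffMeasure ((n : ℝ) - 1)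
          {z : EuclideanSpace ℝ (Fin n) | ‖z‖ = 1 ∧ ∀ i, |z i| ≤ 1 / 2}).toReal /
      (Measure.hausdorffMeasure ((n : ℝ) - 1)
          {z : EuclideanSpace ℝ (Fin n) | ‖z‖ = 1}).toReal)
      atTop (nhds 1) := by
  rw [← tendsto_add_atTop_iff_nat 1]
  have hcast : ∀ m : ℕ, ((m + 1 : ℕ) : ℝ) - 1 = m := fun m => by push_cast; ring
  simp only [hcast]
  refine tendsto_of_tendsto_of_tendsto_of_le_of_le (g := fun m : ℕ => 1 - 48 / ((m : ℝ) + 3))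
    (h := fun _ => 1) ?_ tendsto_const_nhds (fun m => TorusTan.bound m) (fun m => ?_)
  · have h : Tendsto (fun m : ℕ => 48 / ((m : ℝ) + 3)) atTop (nhds 0) :=
      tendsto_const_nhds.div_atTop
        (tendsto_atTop_add_const_right _ _ tendsto_natCast_atTop_atTop)
    simpa using h.const_sub 1
  · refine div_le_one_of_le₀ ?_ ENNReal.toReal_nonneg
    exact ENNReal.toReal_mono (TorusTan.fin_meas m).ne (measure_mono fun z hz => hz.1)
end

section
/- Let w > 0, N ≥ 1, and y₁, …, y_N ∈ ℝ. Define f : ℝ → ℝ by f(t) = Σ_{j=1}^{N} inf_{v ∈ ℤ} (t − y_j − v·w)². Then there exist integers v₁, …, v_N ∈ ℤ such that the point t* = (1/N) Σ_{j=1}^{N} (y_j + w·v_j) is a global minimizer of f: f(t*) ≤ f(t) for all t ∈ ℝ. -/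
lemma tc_bdd (w s : ℝ) : BddBelow (Set.range fun m : ℤ => (s - (m : ℝ) * w) ^ 2) :=
  ⟨0, by rintro _ ⟨m, rfl⟩; positivity⟩

lemma tc_attain (w : ℝ) (hw : 0 < w) (s : ℝ) :
    (s - (round (s / w) : ℝ) * w) ^ 2 ≤ ⨅ m : ℤ, (s - (m : ℝ) * w) ^ 2 := by
  refine le_ciInf fun m => ?_
  have h := round_le (s / w) m
  have e : ∀ k : ℤ, s - (k : ℝ) * w = (s / w - k) * w := by
    intro k; field_simp
  rw [e, e, mul_pow, mul_pow]
  exact mul_le_mul_of_nonneg_right (sq_le_sq.mpr h) (by positivity)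

lemma tc_period (w s : ℝ) (k : ℤ) :
    (⨅ m : ℤ, (s - k * w - (m : ℝ) * w) ^ 2) = ⨅ m : ℤ, (s - (m : ℝ) * w) ^ 2 := by
  refine Equiv.iInf_congr (Equiv.addRight k) fun m => ?_
  simp only [Equiv.coe_addRight]
  push_cast
  ring

lemma tc_centroid (N : ℕ) (hN : 1 ≤ N) (a : Fin N → ℝ) (t : ℝ) :
    ∑ j, ((1 / N : ℝ) * ∑ j', a j' - a j) ^ 2 ≤ ∑ j, (t - a j) ^ 2 := by
  have hN' : (N : ℝ) ≠ 0 := by positivity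
  set c : ℝ := (1 / N : ℝ) * ∑ j', a j' with hc
  have hs : ∑ j', a j' = N * c := by rw [hc]; field_simp
  have key : ∑ j, ((t - a j) ^ 2 - (c - a j) ^ 2) = N * (t - c) ^ 2 := by
    have : ∀ j, (t - a j) ^ 2 - (c - a j) ^ 2 = (t ^ 2 - c ^ 2) - 2 * (t - c) * a j := by
      intro j; ring
    simp only [this, Finset.sum_sub_distrib, ← Finset.mul_sum, hs]
    simp
    ring
  rw [Finset.sum_sub_distrib] at key
  have : 0 ≤ (N : ℝ) * (t - c) ^ 2 := by positivity
  linarith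

/-- the concur projection on the circle `ℝ/(wℤ)`.  For points
`y₁, …, y_N` there is a choice of integer representatives `y_j + w v_j` whose centroid
globally minimizes the sum of squared torus distances
`f(t) = Σ_j inf_{m ∈ ℤ} (t − y_j − m w)²`. -/
theorem torus_concur_minimizer_is_centroid
    (w : ℝ) (hw : 0 < w) (N : ℕ) (hN : 1 ≤ N) (y : Fin N → ℝ) :
    ∃ v : Fin N → ℤ,
      ∀ t : ℝ,
        (∑ j, ⨅ m : ℤ,
          ((1 / N : ℝ) * ∑ j', (y j' + w * v j') - y j - (m : ℝ) * w) ^ 2)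
        ≤ ∑ j, ⨅ m : ℤ, (t - y j - (m : ℝ) * w) ^ 2 := by
  let S : Finset (Fin N → ℤ) := Fintype.piFinset fun j =>
    Finset.Icc (⌊(0 - y j) / w + 1 / 2⌋) (⌊(w - y j) / w + 1 / 2⌋)
  have mem : ∀ t : ℝ, 0 ≤ t → t ≤ w → (fun j => round ((t - y j) / w)) ∈ S := by
    intro t h0 h1
    simp only [S, Fintype.mem_piFinset, Finset.mem_Icc]
    intro j
    rw [round_eq]
    constructor <;> apply Int.floor_le_floor <;> gcongr
  obtain ⟨v, -, hv⟩ := S.exists_min_image (fun v => ∑ j, ⨅ m : ℤ,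
          ((1 / N : ℝ) * ∑ j', (y j' + w * v j') - y j - (m : ℝ) * w) ^ 2)
          ⟨_, mem 0 le_rfl hw.le⟩
  refine ⟨v, fun t => ?_⟩
  set k : ℤ := ⌊t / w⌋
  have hk0 : 0 ≤ t - k * w := by
    have := (le_div_iff₀ hw).1 (Int.floor_le (t / w))
    linarith
  have hk1 : t - k * w ≤ w := by
    have := (div_lt_iff₀ hw).1 (Int.lt_floor_add_one (t / w))
    linarith
  have hper : ∑ j, ⨅ m : ℤ, (t - y j - (m : ℝ) * w) ^ 2
      = ∑ j, ⨅ m : ℤ, ((t - k * w) - y j - (m : ℝ) * w) ^ 2 := by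
    refine Finset.sum_congr rfl fun j _ => ?_
    rw [← tc_period w (t - y j) k, sub_right_comm]
  rw [hper]
  generalize t - k * w = s at hk0 hk1
  refine (hv _ (mem s hk0 hk1)).trans ?_
  set u : Fin N → ℤ := fun j => round ((s - y j) / w) with hu
  calc _ ≤ ∑ j, ((1 / N : ℝ) * ∑ j', (y j' + w * u j') - (y j + w * u j)) ^ 2 := by
        refine Finset.sum_le_sum fun j _ => ?_
        refine (ciInf_le (tc_bdd w _) (u j)).trans (le_of_eq ?_)
        ring
    _ ≤ ∑ j, (s - (y j + w * u j)) ^ 2 := tc_centroid N hN (fun j => y j + w * u j) s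
    _ ≤ _ := by
        refine Finset.sum_le_sum fun j _ => ?_
        refine le_trans (le_of_eq ?_) (tc_attain w hw (s - y j))
        simp only [hu]
        ring
end
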